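/- For every z ∈ Z_{A,−T} = ϱ(H) ∩ ϱ(H_T): (i) Σ̂(−H_T + z)⁻¹ = (−H_T + z)⁻¹ + (A_TG_z)⁻¹G*_{z̄}, so that the restriction of Σ̂ := 1 − A_* to dom(H_T) is bounded with respect to the graph norm of H_T; (ii) Ĝ_z = (−H_T + z)⁻¹ + G_z(A_TG_z)⁻¹ = R_z + G_z(A_TG_z)⁻¹(1 − G*_{z̄}); (iii) ran(Ĝ_z) ⊆ dom(S^×) and Σ̂Ĝ_z = R_z − (1 − G_z)(A_TG_z)⁻¹(1 − G*_{z̄}), a bounded operator on 𝔉. -/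

import Mathlib

noncomputable section

open scoped ComplexInnerProductSpace
open ContinuousLinearMap Filter

variable {F X : Type*}
  [NormedAddCommGroup F] [InnerProductSpace ℂ F] [CompleteSpace F]
  [NormedAddCommGroup X] [InnerProductSpace ℂ X] [CompleteSpace X]

/-- `W R l z = 1 + (z - l) • R`; the point `z` belongs to the resolvent set of the
self-adjoint operator `H` iff `W R l z` is boundedly invertible, where
`R = (-H + λ₀)⁻¹` and `l = λ₀ ∈ ϱ(H) ∩ ℝ` encode `H`. -/
def W (R : F →L[ℂ] F) (l : ℝ) (z : ℂ) : F →L[ℂ] F := 1 + (z - (l : ℂ)) • R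

/-- The resolvent set `ϱ(H)` of `H`, encoded through `R = (-H + λ₀)⁻¹`. -/
def res (R : F →L[ℂ] F) (l : ℝ) : Set ℂ := {z | IsUnit (W R l z)}

/-- The resolvent `R_z = (-H + z)⁻¹`. -/
def Rz (R : F →L[ℂ] F) (l : ℝ) (z : ℂ) : F →L[ℂ] F := R ∘L Ring.inverse (W R l z)

/-- `G_z = (Σ R_z̄)*`, where the bounded operator `B = Σ ∘ R : 𝔉 →L 𝔛` encodes the
(graph-norm bounded) operator `Σ : 𝔥₁ → 𝔛`. -/
def Gz (R : F →L[ℂ] F) (B : F →L[ℂ] X) (l : ℝ) (z : ℂ) : X →L[ℂ] F :=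
  adjoint (B ∘L Ring.inverse (W R l (starRingEnd ℂ z)))

/-- `(-H + λ₀) ψ`, for `ψ ∈ dom H = ran R`. -/
def Hinv (R : F →L[ℂ] F) (ψ : F) : F := Function.invFun (⇑R) ψ

/-- `Σ ψ`, for `ψ ∈ dom H = ran R`. -/
def SigmaOf (R : F →L[ℂ] F) (B : F →L[ℂ] X) (ψ : F) : X := B (Hinv R ψ)

/-- `Q` is the resolvent `(-K + z)⁻¹` of the (in general unbounded) operator `K`. -/
def IsResolventAt (K : F →ₗ.[ℂ] F) (z : ℂ) (Q : F →L[ℂ] F) : Prop :=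
  (∀ ψ : F, Q ψ ∈ K.domain) ∧
  (∀ (ψ : F) (h : Q ψ ∈ K.domain), z • Q ψ - K ⟨Q ψ, h⟩ = ψ) ∧
  (∀ ψ : K.domain, Q (z • (ψ : F) - K ψ) = (ψ : F))

/-- The resolvent set of the (in general unbounded) operator `K`. -/
def pres (K : F →ₗ.[ℂ] F) : Set ℂ := {z | ∃ Q : F →L[ℂ] F, IsResolventAt K z Q}

/-- `A_* ψ`: the (for `ψ ∈ dom S^×` unique) `φ` with `ψ - G φ ∈ 𝔥₁ = ran R`. -/
def Astar (R B : F →L[ℂ] F) (l : ℝ) (ψ : F) : F :=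
  Classical.epsilon fun φ : F => ψ - Gz R B l l φ ∈ Set.range ⇑R

/-- `Σ̂ ψ = (1 - A_*) ψ`. -/
def SigmaHat (R B : F →L[ℂ] F) (l : ℝ) (ψ : F) : F := ψ - Astar R B l ψ

/-- `A₀ ψ = A ψ₀`, where `ψ₀ = ψ - G (A_* ψ)`. -/
def Azero (R B : F →L[ℂ] F) (l : ℝ) (ψ : F) : F :=
  B (Hinv R (ψ - Gz R B l l (Astar R B l ψ)))

/-- `S^× ψ = λ₀ ψ - (-H + λ₀) ψ₀`, where `ψ₀ = ψ - G (A_* ψ)`. -/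
def SxFun (R B : F →L[ℂ] F) (l : ℝ) (ψ : F) : F :=
  (l : ℂ) • ψ - Hinv R (ψ - Gz R B l l (Astar R B l ψ))

/-- `K ∈ B(𝔉)` is a two-sided bounded inverse of `A_T G_z = T - A (G - G_z)`
(with domain `dom T`). -/
def IsInvATG (R B : F →L[ℂ] F) (l : ℝ) (T : F →ₗ.[ℂ] F) (z : ℂ)
    (K : F →L[ℂ] F) : Prop :=
  (∀ y : F, K y ∈ T.domain) ∧
  (∀ (y : F) (h : K y ∈ T.domain),
    T ⟨K y, h⟩ - SigmaOf R B ((Gz R B l l - Gz R B l z) (K y)) = y) ∧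
  (∀ x : T.domain,
    K (T x - SigmaOf R B ((Gz R B l l - Gz R B l z) (x : F))) = (x : F))

theorem adjoint_W {R : F →L[ℂ] F} (hR : IsSelfAdjoint R) (l : ℝ) (z : ℂ) :
    adjoint (W R l (starRingEnd ℂ z)) = W R l z := by
  rw [← star_eq_adjoint]
  simp [W, star_add, star_smul, hR.star_eq]

theorem conj_mem_res {R : F →L[ℂ] F} (hR : IsSelfAdjoint R) {l : ℝ} {z : ℂ}
    (hz : z ∈ res R l) : starRingEnd ℂ z ∈ res R l := by
  have h : star (W R l z) = W R l (starRingEnd ℂ z) := by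
    rw [← adjoint_W hR l z, ← star_eq_adjoint, star_star]
  have hz' : IsUnit (W R l z) := hz
  change IsUnit (W R l (starRingEnd ℂ z))
  rw [← h]
  exact hz'.star

theorem Gz_eq {R B : F →L[ℂ] F} (hR : IsSelfAdjoint R) (l : ℝ) (z : ℂ) :
    Gz R B l z = Ring.inverse (W R l z) ∘L adjoint B := by
  rw [Gz, adjoint_comp, ← star_eq_adjoint (Ring.inverse _), ← Ring.inverse_star,
    star_eq_adjoint, adjoint_W hR]

theorem Gz_self {R B : F →L[ℂ] F} (l : ℝ) : Gz R B l l = adjoint B := by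
  have h : W R l (starRingEnd ℂ l) = 1 := by simp [W]
  rw [Gz, h, Ring.inverse_one]
  rfl

theorem Gz_sub_apply {R B : F →L[ℂ] F} (hR : IsSelfAdjoint R) {l : ℝ} {z : ℂ}
    (hz : z ∈ res R l) (x : F) :
    (Gz R B l l - Gz R B l z) x = R ((z - (l : ℂ)) • Gz R B l z x) := by
  have h : W R l z (Gz R B l z x) = adjoint B x := by
    rw [Gz_eq hR]
    exact DFunLike.congr_fun (Ring.mul_inverse_cancel _ hz) (adjoint B x)
  rw [sub_apply, Gz_self, ← h]
  simp [W]

theorem Hinv_apply {R : F →L[ℂ] F} (hinj : Function.Injective ⇑R) (x : F) :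
    Hinv R (R x) = x :=
  Function.leftInverse_invFun hinj x

theorem SigmaOf_Gz_sub {R B : F →L[ℂ] F} (hR : IsSelfAdjoint R)
    (hinj : Function.Injective ⇑R) {l : ℝ} {z : ℂ} (hz : z ∈ res R l) (x : F) :
    SigmaOf R B ((Gz R B l l - Gz R B l z) x) = (z - (l : ℂ)) • B (Gz R B l z x) := by
  rw [Gz_sub_apply hR hz, SigmaOf, Hinv_apply hinj, map_smul]

theorem inner_SigmaOf_Gz_sub {R B : F →L[ℂ] F} (hR : IsSelfAdjoint R)
    (hinj : Function.Injective ⇑R) {l : ℝ} {z : ℂ} (hz : z ∈ res R l) (x y : F) :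
    ⟪SigmaOf R B ((Gz R B l l - Gz R B l (starRingEnd ℂ z)) x), y⟫
      = ⟪x, SigmaOf R B ((Gz R B l l - Gz R B l z) y)⟫ := by
  rw [SigmaOf_Gz_sub hR hinj hz, SigmaOf_Gz_sub hR hinj (conj_mem_res hR hz),
    inner_smul_left, inner_smul_right, ← adjoint_inner_right B]
  congr 1
  · simp
  · rw [← adjoint_inner_right, Gz, adjoint_adjoint, Gz_eq hR, Complex.conj_conj]
    simp only [comp_apply]

theorem Astar_eq {R B : F →L[ℂ] F} {l : ℝ}
    (hkerG : Function.Injective ⇑(Gz R B l l))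
    (hranG : Set.range ⇑(Gz R B l l) ∩ Set.range ⇑R = {0}) {ψ φ : F}
    (h : ψ - Gz R B l l φ ∈ Set.range ⇑R) : Astar R B l ψ = φ := by
  have h' : ψ - Gz R B l l (Astar R B l ψ) ∈ Set.range ⇑R :=
    Classical.epsilon_spec (p := fun φ : F => ψ - Gz R B l l φ ∈ Set.range ⇑R) ⟨φ, h⟩
  obtain ⟨a, ha⟩ := h
  obtain ⟨b, hb⟩ := h'
  have h0 : Gz R B l l (Astar R B l ψ - φ) ∈ ({0} : Set F) := by
    rw [← hranG]
    refine ⟨⟨_, rfl⟩, a - b, ?_⟩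
    rw [map_sub, map_sub, ha, hb]
    abel
  exact sub_eq_zero.mp (hkerG (by rw [Set.mem_singleton_iff.mp h0, map_zero]))

theorem IsResolventAt.unique {K : F →ₗ.[ℂ] F} {z : ℂ} {P Q : F →L[ℂ] F}
    (hP : IsResolventAt K z P) (hQ : IsResolventAt K z Q) : P = Q := by
  ext ψ
  have h := hQ.2.2 ⟨P ψ, hP.1 ψ⟩
  rw [hP.2.1 ψ (hP.1 ψ)] at h
  exact h.symm

theorem inner_apply_of_isSelfAdjoint {T : F →ₗ.[ℂ] F} (hT : IsSelfAdjoint T)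
    (x y : T.domain) : ⟪T x, (y : F)⟫ = ⟪(x : F), T y⟫ := by
  have h := LinearPMap.adjoint_isFormalAdjoint hT.dense_domain
  rw [LinearPMap.isSelfAdjoint_def.mp hT] at h
  exact h x y

theorem IsResolventAt.adjoint {K : F →ₗ.[ℂ] F} (hK : IsSelfAdjoint K) {z : ℂ}
    {Q : F →L[ℂ] F} (hQ : IsResolventAt K z Q) :
    IsResolventAt K (starRingEnd ℂ z) (ContinuousLinearMap.adjoint Q) := by
  have key (y : F) (x : K.domain) :
      ⟪starRingEnd ℂ z • ContinuousLinearMap.adjoint Q y - y, (x : F)⟫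
        = ⟪ContinuousLinearMap.adjoint Q y, K x⟫ := by
    have h := hQ.2.2 x
    rw [map_sub, map_smul, sub_eq_iff_eq_add, ← sub_eq_iff_eq_add'] at h
    rw [adjoint_inner_left, ← h, inner_sub_left, inner_smul_left, inner_sub_right,
      inner_smul_right, adjoint_inner_left, Complex.conj_conj]
  have hmem (y : F) : ContinuousLinearMap.adjoint Q y ∈ K.domain := by
    have h := LinearPMap.mem_adjoint_domain_of_exists (T := K)
      (ContinuousLinearMap.adjoint Q y) ⟨_, key y⟩
    rwa [LinearPMap.isSelfAdjoint_def.mp hK] at h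
  refine ⟨hmem, fun y h => ?_, fun ψ => ?_⟩
  · have hy : K ⟨ContinuousLinearMap.adjoint Q y, h⟩
        = starRingEnd ℂ z • ContinuousLinearMap.adjoint Q y - y := by
      refine hK.dense_domain.eq_of_inner_left (𝕜 := ℂ) fun v hv => ?_
      rw [key y ⟨v, hv⟩]
      exact inner_apply_of_isSelfAdjoint hK ⟨_, h⟩ ⟨v, hv⟩
    rw [hy]
    abel
  · refine ext_inner_right ℂ fun φ => ?_
    rw [adjoint_inner_left, inner_sub_left, inner_smul_left, Complex.conj_conj]
    have h := inner_apply_of_isSelfAdjoint hK ψ ⟨Q φ, hQ.1 φ⟩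
    dsimp only at h
    rw [h, ← inner_smul_right, ← inner_sub_right, hQ.2.1 φ (hQ.1 φ)]

theorem IsInvATG.adjoint_eq {R B : F →L[ℂ] F} (hR : IsSelfAdjoint R)
    (hinj : Function.Injective ⇑R) {l : ℝ} {T : F →ₗ.[ℂ] F} (hT : IsSelfAdjoint T)
    {z : ℂ} (hz : z ∈ res R l) {K K' : F →L[ℂ] F} (hK : IsInvATG R B l T z K)
    (hK' : IsInvATG R B l T (starRingEnd ℂ z) K') : adjoint K' = K := by
  refine ((eq_adjoint_iff K K').mpr fun x y => ?_).symm
  have h := inner_apply_of_isSelfAdjoint hT ⟨K' y, hK'.1 y⟩ ⟨K x, hK.1 x⟩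
  have h2 := inner_SigmaOf_Gz_sub (B := B) hR hinj hz (K' y) (K x)
  have h3 : ⟪y, K x⟫ = ⟪K' y, x⟫ := by
    conv_lhs => rw [← hK'.2.1 y (hK'.1 y)]
    conv_rhs => rw [← hK.2.1 x (hK.1 x)]
    rw [inner_sub_left, inner_sub_right, h2]
    exact congrArg (· - _) h
  rw [← inner_conj_symm, h3, inner_conj_symm]

theorem sub_Gz_mem_range {R B : F →L[ℂ] F} (hR : IsSelfAdjoint R) {l : ℝ} {z : ℂ}
    (hz : z ∈ res R l) (ψ φ : F) :
    Rz R l z ψ + Gz R B l z φ - Gz R B l l φ ∈ Set.range ⇑R := by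
  refine ⟨Ring.inverse (W R l z) ψ - (z - (l : ℂ)) • Gz R B l z φ, ?_⟩
  rw [map_sub, ← Gz_sub_apply hR hz, sub_apply, Rz, comp_apply]
  abel

theorem SigmaHat_eq {R B : F →L[ℂ] F} (hR : IsSelfAdjoint R) {l : ℝ}
    (hkerG : Function.Injective ⇑(Gz R B l l))
    (hranG : Set.range ⇑(Gz R B l l) ∩ Set.range ⇑R = {0}) {z : ℂ}
    (hz : z ∈ res R l) (ψ φ : F) :
    SigmaHat R B l (Rz R l z ψ + Gz R B l z φ) = Rz R l z ψ + Gz R B l z φ - φ := by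
  rw [SigmaHat, Astar_eq hkerG hranG (sub_Gz_mem_range hR hz ψ φ)]

/-- For every `z ∈ Z_{A,-T} = ϱ(H) ∩ ϱ(H_T)`:
(i) `Σ̂ (-H_T + z)⁻¹ = (-H_T + z)⁻¹ + (A_T G_z)⁻¹ G_z̄*`, so `Σ̂|dom H_T` is bounded
w.r.t. the graph norm of `H_T`;
(ii) `Ĝ_z = (-H_T + z)⁻¹ + G_z (A_T G_z)⁻¹ = R_z + G_z (A_T G_z)⁻¹ (1 - G_z̄*)`;
(iii) `ran Ĝ_z ⊆ dom S^×` and `Σ̂ Ĝ_z = R_z - (1 - G_z)(A_T G_z)⁻¹(1 - G_z̄*)`. -/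
theorem statement12
    (R B : F →L[ℂ] F) (l : ℝ)
    (hR : IsSelfAdjoint R) (hinj : Function.Injective ⇑R)
    (hkerG : Function.Injective ⇑(Gz R B l l))
    (hranG : Set.range ⇑(Gz R B l l) ∩ Set.range ⇑R = {0})
    (T : F →ₗ.[ℂ] F) (hT : IsSelfAdjoint T)
    (HT : F →ₗ.[ℂ] F) (hHTsa : IsSelfAdjoint HT)
    (hHTdom : (HT.domain : Set F)
      = {ψ | ∃ (φ : F) (h : ψ - Gz R B l l φ ∈ Set.range ⇑R) (hφ : φ ∈ T.domain),
          SigmaOf R B (ψ - Gz R B l l φ) + T ⟨φ, hφ⟩ = 0})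
    (hHTact : ∀ (ψ : HT.domain) (φ : F),
      (ψ : F) - Gz R B l l φ ∈ Set.range ⇑R →
      HT ψ = (l : ℂ) • (ψ : F) - Hinv R ((ψ : F) - Gz R B l l φ))
    (hZeq : ∀ z : ℂ, z ∈ res R l ∩ pres HT ↔
      (z ∈ res R l ∧ ∃ K : F →L[ℂ] F, IsInvATG R B l T z K))
    (hZne : (res R l ∩ pres HT).Nonempty)
    (hHTres : ∀ z ∈ res R l ∩ pres HT, ∀ K : F →L[ℂ] F, IsInvATG R B l T z K →
      IsResolventAt HT z
        (Rz R l z - Gz R B l z ∘L K ∘L adjoint (Gz R B l (starRingEnd ℂ z))))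
    (Ghat : ℂ → F →L[ℂ] F)
    (hGhat : ∀ z ∈ pres HT, ∀ Q : F →L[ℂ] F,
      IsResolventAt HT (starRingEnd ℂ z) Q →
      ∀ φ ψ : F, ⟪Ghat z φ, ψ⟫ = ⟪φ, SigmaHat R B l (Q ψ)⟫)
    (z : ℂ) (hz : z ∈ res R l ∩ pres HT)
    (QT K : F →L[ℂ] F) (hQT : IsResolventAt HT z QT)
    (hK : IsInvATG R B l T z K) :
    ((∀ ψ : F, SigmaHat R B l (QT ψ)
        = QT ψ + K (adjoint (Gz R B l (starRingEnd ℂ z)) ψ)) ∧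
      ∃ c : ℝ, ∀ ψ : HT.domain,
        ‖SigmaHat R B l (ψ : F)‖ ≤ c * (‖(ψ : F)‖ + ‖HT ψ‖)) ∧
    (Ghat z = QT + Gz R B l z ∘L K ∧
      Ghat z = Rz R l z
        + Gz R B l z ∘L K ∘L (1 - adjoint (Gz R B l (starRingEnd ℂ z)))) ∧
    ((∀ φ : F, ∃ φ' : F, Ghat z φ - Gz R B l l φ' ∈ Set.range ⇑R) ∧
      ∀ φ : F, SigmaHat R B l (Ghat z φ)
        = ((Rz R l z
            - (1 - Gz R B l z) ∘L K ∘L (1 - adjoint (Gz R B l (starRingEnd ℂ z)))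
            : F →L[ℂ] F)) φ) := by
  have hform {w : ℂ} (hw : w ∈ res R l ∩ pres HT) {Q L : F →L[ℂ] F}
      (hQ : IsResolventAt HT w Q) (hL : IsInvATG R B l T w L) :
      Q = Rz R l w - Gz R B l w ∘L L ∘L adjoint (Gz R B l (starRingEnd ℂ w)) :=
    hQ.unique (hHTres w hw L hL)
  have hSigma {w : ℂ} (hw : w ∈ res R l ∩ pres HT) {Q L : F →L[ℂ] F}
      (hQ : IsResolventAt HT w Q) (hL : IsInvATG R B l T w L) (ψ : F) :
      SigmaHat R B l (Q ψ) = Q ψ + L (adjoint (Gz R B l (starRingEnd ℂ w)) ψ) := by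
    have h : Q ψ = Rz R l w ψ
        + Gz R B l w (-L (adjoint (Gz R B l (starRingEnd ℂ w)) ψ)) := by
      rw [hform hw hQ hL]
      simp [sub_eq_add_neg]
    rw [h, SigmaHat_eq hR hkerG hranG hw.1, sub_neg_eq_add]
  have hQ' := hQT.adjoint hHTsa
  have hz' : starRingEnd ℂ z ∈ res R l ∩ pres HT := ⟨conj_mem_res hR hz.1, _, hQ'⟩
  obtain ⟨-, K', hK'⟩ := (hZeq _).mp hz'
  have hG1 : Ghat z = QT + Gz R B l z ∘L K := by
    ext φ
    refine ext_inner_right ℂ fun ψ => ?_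
    rw [hGhat z hz.2 _ hQ', hSigma hz' hQ' hK', Complex.conj_conj, inner_add_right,
      adjoint_inner_right, ← adjoint_inner_left K', adjoint_inner_right,
      hK.adjoint_eq hR hinj hT hz.1 hK', ← inner_add_left]
    rfl
  have hG2 : Ghat z = Rz R l z
      + Gz R B l z ∘L K ∘L (1 - adjoint (Gz R B l (starRingEnd ℂ z))) := by
    rw [hG1, hform hz hQT hK]
    ext φ
    simp only [add_apply, sub_apply, comp_apply, map_sub]
    abel
  have hG3 (φ : F) : Ghat z φ = Rz R l z φ
      + Gz R B l z (K ((1 - adjoint (Gz R B l (starRingEnd ℂ z))) φ)) := by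
    rw [hG2]
    rfl
  refine ⟨⟨hSigma hz hQT hK, ?_⟩, ⟨hG1, hG2⟩, fun φ =>
    ⟨K ((1 - adjoint (Gz R B l (starRingEnd ℂ z))) φ), ?_⟩, fun φ => ?_⟩
  · set S : F →L[ℂ] F := QT + K ∘L adjoint (Gz R B l (starRingEnd ℂ z))
    refine ⟨‖S‖ * (‖z‖ + 1), fun ψ => ?_⟩
    have h : SigmaHat R B l (ψ : F) = S (z • (ψ : F) - HT ψ) := by
      conv_lhs => rw [← hQT.2.2 ψ]
      exact hSigma hz hQT hK _
    rw [h, mul_assoc]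
    refine (S.le_opNorm _).trans (mul_le_mul_of_nonneg_left ?_ (norm_nonneg S))
    refine (norm_sub_le _ _).trans ?_
    rw [norm_smul]
    nlinarith [norm_nonneg z, norm_nonneg (ψ : F), norm_nonneg (HT ψ),
      mul_nonneg (norm_nonneg z) (norm_nonneg (HT ψ))]
  · rw [hG3]
    exact sub_Gz_mem_range hR hz.1 _ _
  · rw [hG3, SigmaHat_eq hR hkerG hranG hz.1]
    simp only [sub_apply, comp_apply, map_sub]
    abel
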